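/- Let n ≥ 2 and let Φ : ℝⁿ → ℂ be a Schwartz function. There is a constant C > 0, depending only on Φ and n, such that for all s ≥ 1, all orthonormal unit vectors e₁, e₂ ∈ ℝⁿ, and every Schwartz function u : ℝⁿ → ℂ: ∫_{ℝⁿ} (s + |p_ζ(ξ)|) |𝓕(Φu)(ξ)|² dξ ≤ C ∫_{ℝⁿ} |p_ζ(ξ)| |𝓕u(ξ)|² dξ. (Equivalently, ‖Φu‖_{X^{1/2}_ζ} ≲ ‖u‖_{Ẋ^{1/2}_ζ}: multiplication by a Schwartz cutoff maps the homogeneous Bourgain space into the inhomogeneous one.) -/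

import Mathlib

open MeasureTheory
open scoped RealInnerProductSpace FourierTransform

/-- The modulus `|p_ζ(ξ)|` of the symbol `p_ζ(ξ) = -‖ξ‖² + 2iζ·ξ` of the conjugated
Laplacian `Δ + 2ζ·∇`, where `ζ = s(e₁ - i e₂)`. -/
noncomputable def pAbs {n : ℕ} (s : ℝ) (e₁ e₂ ξ : EuclideanSpace ℝ (Fin n)) : ℝ :=
  Real.sqrt ((‖ξ‖ ^ 2 - 2 * s * ⟪e₂, ξ⟫) ^ 2 + 4 * s ^ 2 * ⟪e₁, ξ⟫ ^ 2)

open scoped ENNReal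

/-- Weighted Schur test for convolution operators. -/
theorem lintegral_mul_convolution_sq_le {E : Type*} [NormedAddCommGroup E] [MeasurableSpace E]
    [BorelSpace E] [SecondCountableTopology E] {μ : Measure E} [SFinite μ] [μ.IsAddRightInvariant]
    {F U P Q : E → ℝ≥0∞} {C : ℝ≥0∞} (hF : Measurable F) (hU : Measurable U) (hP : Measurable P)
    (hPtop : ∀ η, P η ≠ ∞) (hQ0 : ∀ ξ, Q ξ ≠ 0) (hC : C ≠ ∞)
    (h : ∀ ξ, Q ξ * ∫⁻ η, F (ξ - η) / P η ∂μ ≤ C) :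
    ∫⁻ ξ, Q ξ * (∫⁻ η, F (ξ - η) * U η ∂μ) ^ 2 ∂μ ≤
      C * (∫⁻ ξ, F ξ ∂μ) * ∫⁻ η, P η * U η ^ 2 ∂μ := by
  have hPU : Measurable fun η => P η * U η ^ 2 := hP.mul (hU.pow_const 2)
  have cauchy : ∀ ξ, (∫⁻ η, F (ξ - η) * U η ∂μ) ^ 2 ≤
      (∫⁻ η, F (ξ - η) / P η ∂μ) * ∫⁻ η, F (ξ - η) * (P η * U η ^ 2) ∂μ := by
    intro ξ
    have hFξ : Measurable fun η => F (ξ - η) := hF.comp (measurable_const.sub measurable_id)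
    have hFPU : Measurable fun η => F (ξ - η) * (P η * U η ^ 2) := hFξ.mul hPU
    have hfin : ∫⁻ η, F (ξ - η) / P η ∂μ ≠ ∞ := by
      intro htop
      have := h ξ
      rw [htop, ENNReal.mul_top (hQ0 ξ)] at this
      exact hC (top_le_iff.1 this)
    have hae := ae_lt_top (hFξ.div hP) hfin
    have hle : ∫⁻ η, F (ξ - η) * U η ∂μ ≤
        ∫⁻ η, (F (ξ - η) / P η) ^ (1 / 2 : ℝ) *
          (F (ξ - η) * (P η * U η ^ 2)) ^ (1 / 2 : ℝ) ∂μ := by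
      refine lintegral_mono_ae ?_
      filter_upwards [hae] with η hη
      rcases eq_or_ne (F (ξ - η)) 0 with h0 | h0
      · simp [h0]
      have hP0 : P η ≠ 0 := fun h' => by
        simp [h', ENNReal.div_zero h0] at hη
      rw [← ENNReal.mul_rpow_of_nonneg _ _ (by norm_num)]
      have : F (ξ - η) / P η * (F (ξ - η) * (P η * U η ^ 2)) = (F (ξ - η) * U η) ^ 2 := by
        calc _ = (P η)⁻¹ * P η * (F (ξ - η) * U η) ^ 2 := by rw [div_eq_mul_inv]; ring
          _ = _ := by rw [ENNReal.inv_mul_cancel hP0 (hPtop η), one_mul]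
      rw [this, ← ENNReal.rpow_natCast, ← ENNReal.rpow_mul]
      norm_num
    have holder := ENNReal.lintegral_mul_le_Lp_mul_Lq μ Real.HolderConjugate.two_two
      (f := fun η => (F (ξ - η) / P η) ^ (1 / 2 : ℝ))
      (g := fun η => (F (ξ - η) * (P η * U η ^ 2)) ^ (1 / 2 : ℝ))
      ((hFξ.div hP).pow_const _).aemeasurable
      (hFPU.pow_const _).aemeasurable
    simp only [Pi.mul_apply, ← ENNReal.rpow_mul] at holder
    norm_num at holder
    norm_num at hle
    calc _ ≤ _ := pow_le_pow_left₀ zero_le (hle.trans holder) 2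
      _ = _ := by
        rw [mul_pow, ← ENNReal.rpow_natCast, ← ENNReal.rpow_natCast, ← ENNReal.rpow_mul,
          ← ENNReal.rpow_mul]
        norm_num
  have hF2 : Measurable fun p : E × E => F (p.1 - p.2) := hF.comp (measurable_fst.sub measurable_snd)
  calc ∫⁻ ξ, Q ξ * (∫⁻ η, F (ξ - η) * U η ∂μ) ^ 2 ∂μ
      ≤ ∫⁻ ξ, C * ∫⁻ η, F (ξ - η) * (P η * U η ^ 2) ∂μ ∂μ := by
        refine lintegral_mono fun ξ => ?_
        calc _ ≤ Q ξ * ((∫⁻ η, F (ξ - η) / P η ∂μ) * ∫⁻ η, F (ξ - η) * (P η * U η ^ 2) ∂μ) := by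
              gcongr; exact cauchy ξ
          _ ≤ _ := by rw [← mul_assoc]; gcongr; exact h ξ
    _ = C * ∫⁻ η, ∫⁻ ξ, F (ξ - η) * (P η * U η ^ 2) ∂μ ∂μ := by
        have hm : Measurable (Function.uncurry fun ξ η => F (ξ - η) * (P η * U η ^ 2)) :=
          hF2.mul (hPU.comp measurable_snd)
        rw [lintegral_const_mul C hm.lintegral_prod_right, lintegral_lintegral_swap hm.aemeasurable]
    _ = _ := by
        have : ∀ η, ∫⁻ ξ, F (ξ - η) * (P η * U η ^ 2) ∂μ = (∫⁻ ξ, F ξ ∂μ) * (P η * U η ^ 2) := by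
          intro η
          rw [lintegral_mul_const _ (by fun_prop),
            lintegral_sub_right_eq_self F η]
        simp_rw [this]
        rw [lintegral_const_mul _ hPU, mul_assoc]

/-- The norm of the Fourier transform of a product is dominated by a convolution. -/
theorem SchwartzMap.enorm_fourier_mul_le {E : Type*} [NormedAddCommGroup E] [InnerProductSpace ℝ E]
    [FiniteDimensional ℝ E] [MeasurableSpace E] [BorelSpace E] (f g : SchwartzMap E ℂ) (ξ : E) :
    ‖𝓕 (fun x => f x * g x) ξ‖ₑ ≤ ∫⁻ η, ‖𝓕 (⇑f) (ξ - η)‖ₑ * ‖𝓕 (⇑g) η‖ₑ := by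
  set B := ContinuousLinearMap.mul ℂ ℂ
  set A := SchwartzMap.convolution B (𝓕⁻ f) (𝓕⁻ g)
  have h1 : (fun x => f x * g x) = ⇑(𝓕 A : SchwartzMap E ℂ) := by
    ext x
    simp [A, B, SchwartzMap.fourier_convolution]
  have h2 : 𝓕 (fun x => f x * g x) ξ = A (-ξ) := by
    rw [h1, ← SchwartzMap.fourier_coe]
    have : 𝓕 (𝓕 A : SchwartzMap E ℂ) ξ = 𝓕⁻ (𝓕 A : SchwartzMap E ℂ) (-ξ) := by
      rw [SchwartzMap.fourier_coe, SchwartzMap.fourierInv_coe, Real.fourierInv_eq_fourier_neg, neg_neg]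
    rw [this]; simp
  rw [h2, SchwartzMap.convolution_apply, MeasureTheory.convolution_def]
  refine (enorm_integral_le_lintegral_enorm _).trans (le_of_eq ?_)
  rw [← lintegral_add_left_eq_self (fun η => ‖𝓕 (⇑f) (ξ - η)‖ₑ * ‖𝓕 (⇑g) η‖ₑ) ξ]
  refine lintegral_congr fun t => ?_
  simp only [B, ContinuousLinearMap.mul_apply', enorm_mul, SchwartzMap.fourierInv_coe,
    Real.fourierInv_eq_fourier_neg]
  congr 3 <;> abel_nf

theorem lintegral_ofReal_inv_one_add_sq_ne_top :
    ∫⁻ t : ℝ, ENNReal.ofReal (1 + t ^ 2)⁻¹ ≠ ∞ :=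
  integrable_inv_one_add_sq.lintegral_lt_top.ne

theorem lintegral_Icc_inv_sqrt_abs_ne_top :
    ∫⁻ t in Set.Icc (-1 : ℝ) 1, (ENNReal.ofReal √|t|)⁻¹ ≠ ∞ := by
  have h0 : IntervalIntegrable (fun t : ℝ => (√|t|)⁻¹) volume 0 1 := by
    refine (intervalIntegral.intervalIntegrable_rpow' (r := -(1 / 2)) (by norm_num)).congr ?_
    intro t ht
    rw [Set.uIoc_of_le zero_le_one] at ht
    simp only [abs_of_pos ht.1, Real.sqrt_eq_rpow, Real.rpow_neg ht.1.le]
  have h1 : IntervalIntegrable (fun t : ℝ => (√|t|)⁻¹) volume (-1) 0 := by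
    simpa using ((IntervalIntegrable.iff_comp_neg (by finiteness)).1 h0).symm
  have h2 : IntegrableOn (fun t : ℝ => (√|t|)⁻¹) (Set.Icc (-1) 1) := by
    rw [integrableOn_Icc_iff_integrableOn_Ioc,
      ← intervalIntegrable_iff_integrableOn_Ioc_of_le (by norm_num)]
    exact h1.trans h0
  refine ne_of_eq_of_ne (lintegral_congr_ae ?_) h2.lintegral_lt_top.ne
  refine ae_restrict_of_ae ?_
  filter_upwards [Measure.ae_ne volume (0 : ℝ)] with t ht
  rw [ENNReal.ofReal_inv_of_pos (Real.sqrt_pos.2 (abs_pos.2 ht))]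

theorem exists_lintegral_inv_one_add_sq_mul_inv_sqrt_le :
    ∃ C : ℝ≥0∞, C ≠ ∞ ∧ ∀ a b : ℝ,
      ∫⁻ t : ℝ, ENNReal.ofReal (1 + (t - a) ^ 2)⁻¹ * (ENNReal.ofReal √|t - b|)⁻¹ ≤ C := by
  refine ⟨(∫⁻ t : ℝ, ENNReal.ofReal (1 + t ^ 2)⁻¹) +
    ∫⁻ t in Set.Icc (-1 : ℝ) 1, (ENNReal.ofReal √|t|)⁻¹,
    ENNReal.add_ne_top.2 ⟨lintegral_ofReal_inv_one_add_sq_ne_top,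
      lintegral_Icc_inv_sqrt_abs_ne_top⟩, fun a b => ?_⟩
  set k : ℝ → ℝ≥0∞ := (Set.Icc (-1 : ℝ) 1).indicator fun t => (ENNReal.ofReal √|t|)⁻¹
  calc _ ≤ ∫⁻ t : ℝ, (ENNReal.ofReal (1 + (t - a) ^ 2)⁻¹ + k (t - b)) := by
        refine lintegral_mono fun t => ?_
        by_cases ht : t - b ∈ Set.Icc (-1 : ℝ) 1
        · simp only [k, Set.indicator_of_mem ht]
          refine le_add_left (mul_le_of_le_one_left zero_le ?_)
          rw [ENNReal.ofReal_le_one]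
          exact inv_le_one_of_one_le₀ (by nlinarith [sq_nonneg (t - a)])
        · refine le_add_right (mul_le_of_le_one_right zero_le ?_)
          rw [ENNReal.inv_le_one, ENNReal.one_le_ofReal, Real.one_le_sqrt]
          rw [Set.mem_Icc, ← abs_le] at ht
          exact (not_le.1 ht).le
    _ = _ := by
        rw [lintegral_add_left (by fun_prop),
          lintegral_sub_right_eq_self (fun t : ℝ => ENNReal.ofReal (1 + t ^ 2)⁻¹) a,
          lintegral_sub_right_eq_self k b, lintegral_indicator measurableSet_Icc]

theorem ENNReal.div_le_natCast_mul_inv_mul_inv {a u v P : ℝ≥0∞} {n : ℕ} (hn : n ≠ 0) (hu : u ≠ ∞)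
    (hv : v ≠ ∞) (h : a * u * v ≤ n * P) : a / P ≤ n * (u⁻¹ * v⁻¹) := by
  have hn' : (n : ℝ≥0∞) ≠ 0 := Nat.cast_ne_zero.2 hn
  rcases eq_or_ne u 0 with rfl | hu0
  · simp [ENNReal.top_mul (ENNReal.inv_ne_zero.2 hv), ENNReal.mul_top hn']
  rcases eq_or_ne v 0 with rfl | hv0
  · simp [ENNReal.mul_top (ENNReal.inv_ne_zero.2 hu), ENNReal.mul_top hn']
  refine ENNReal.div_le_of_le_mul ?_
  calc a = a * u * v * (u⁻¹ * v⁻¹) := by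
        calc a = a * (u * u⁻¹) * (v * v⁻¹) := by
              rw [ENNReal.mul_inv_cancel hu0 hu, ENNReal.mul_inv_cancel hv0 hv, mul_one, mul_one]
          _ = _ := by ring
    _ ≤ n * P * (u⁻¹ * v⁻¹) := by gcongr
    _ = _ := by ring

theorem mul_sqrt_abs_mul_sqrt_abs_le {s x y A n : ℝ} (hs : 0 ≤ s) (hn : 1 ≤ n)
    (h : s * |y| ≤ 2 * n * |A|) :
    s * √|x| * √|y| ≤ n * √(A ^ 2 + 4 * s ^ 2 * x ^ 2) := by
  refine abs_le_of_sq_le_sq' ?_ (by positivity) |>.2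
  rw [mul_pow, mul_pow, mul_pow, Real.sq_sqrt (abs_nonneg _), Real.sq_sqrt (abs_nonneg _),
    Real.sq_sqrt (by positivity)]
  have h1 : s * |x| * (s * |y|) ≤ s * |x| * (2 * n * |A|) := by gcongr
  have h2 : 4 * (s * |x|) * |A| ≤ A ^ 2 + 4 * s ^ 2 * x ^ 2 := by
    have := sq_nonneg (|A| - 2 * (s * |x|))
    rw [← sq_abs A, ← sq_abs x]
    nlinarith
  have h3 : 0 ≤ A ^ 2 + 4 * s ^ 2 * x ^ 2 := by positivity
  calc s ^ 2 * |x| * |y| = s * |x| * (s * |y|) := by ring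
    _ ≤ n * (4 * (s * |x|) * |A|) / 2 := by linarith
    _ ≤ n * (A ^ 2 + 4 * s ^ 2 * x ^ 2) := by nlinarith
    _ ≤ _ := by nlinarith [mul_nonneg (sub_nonneg.2 hn) h3]

theorem mul_abs_sub_sqrt_le {s t r n : ℝ} (hn : 0 < n) (ht : 0 ≤ t) (h : s ≤ 2 * n * t) :
    s * |t - √r| ≤ 2 * n * |t ^ 2 - r| := by
  have key : t * |t - √r| ≤ |t ^ 2 - r| := by
    rcases le_total 0 r with hr | hr
    · have : t ^ 2 - r = (t + √r) * (t - √r) := by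
        nlinarith [Real.sq_sqrt hr]
      rw [this, abs_mul, abs_of_nonneg (by positivity : 0 ≤ t + √r)]
      gcongr
      linarith [Real.sqrt_nonneg r]
    · rw [Real.sqrt_eq_zero_of_nonpos hr, sub_zero, abs_of_nonneg ht, abs_of_nonneg (by nlinarith)]
      nlinarith
  calc _ ≤ 2 * n * t * |t - √r| := by gcongr
    _ ≤ _ := by rw [mul_assoc]; gcongr

/-- Pointwise bound of the normalized reciprocal symbol, in coordinates centred at the centre of
the characteristic sphere, by integrable singularities in two coordinates. -/
theorem ofReal_div_ofReal_sqrt_le {n : ℕ} {s : ℝ} (hs : 1 ≤ s) (i : Fin n) (x : Fin n → ℝ) :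
    ENNReal.ofReal s / ENNReal.ofReal √((∑ k, x k ^ 2 - s ^ 2) ^ 2 + 4 * s ^ 2 * x i ^ 2) ≤
      2 + ∑ j ∈ Finset.univ.erase i, n * ((ENNReal.ofReal √|x i|)⁻¹ *
        (ENNReal.ofReal √|x j - √(s ^ 2 - ∑ k ∈ Finset.univ.erase j, x k ^ 2)|)⁻¹ +
        (ENNReal.ofReal √|x i|)⁻¹ *
        (ENNReal.ofReal √|x j - -√(s ^ 2 - ∑ k ∈ Finset.univ.erase j, x k ^ 2)|)⁻¹) := by
  have hn : 0 < n := i.pos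
  have hnR : (1 : ℝ) ≤ n := by exact_mod_cast hn
  by_cases hj : ∃ j, j ≠ i ∧ s ≤ 2 * n * |x j|
  · obtain ⟨j, hji, hj⟩ := hj
    refine le_add_left (le_trans ?_ (Finset.single_le_sum (fun _ _ => zero_le)
      (Finset.mem_erase.2 ⟨hji, Finset.mem_univ j⟩)))
    set r := s ^ 2 - ∑ k ∈ Finset.univ.erase j, x k ^ 2 with hr
    have hA : ∑ k, x k ^ 2 - s ^ 2 = |x j| ^ 2 - r := by
      rw [hr, ← Finset.add_sum_erase _ _ (Finset.mem_univ j), sq_abs]; ring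
    have h1 := mul_abs_sub_sqrt_le (r := r) (by linarith) (abs_nonneg (x j)) hj
    rw [← hA] at h1
    have h2 : ∀ y : ℝ, |y| = |(|x j| - √r)| →
        ENNReal.ofReal s / ENNReal.ofReal √((∑ k, x k ^ 2 - s ^ 2) ^ 2 + 4 * s ^ 2 * x i ^ 2) ≤
          n * ((ENNReal.ofReal √|x i|)⁻¹ * (ENNReal.ofReal √|y|)⁻¹) := by
      intro y hy
      refine ENNReal.div_le_natCast_mul_inv_mul_inv hn.ne' ENNReal.ofReal_ne_top
        ENNReal.ofReal_ne_top ?_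
      rw [← ENNReal.ofReal_mul (by linarith), ← ENNReal.ofReal_mul (by positivity),
        ← ENNReal.ofReal_natCast, ← ENNReal.ofReal_mul (by positivity)]
      exact ENNReal.ofReal_le_ofReal
        (mul_sqrt_abs_mul_sqrt_abs_le (by linarith) hnR (by rwa [hy]))
    rw [mul_add]
    rcases le_total 0 (x j) with h0 | h0
    · exact le_add_right (h2 _ (by rw [abs_of_nonneg h0]))
    · exact le_add_left (h2 _ (by rw [abs_of_nonpos h0, ← abs_neg]; ring_nf))
  · push Not at hj
    refine le_add_right (ENNReal.div_le_of_le_mul ?_)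
    rw [show (2 : ℝ≥0∞) = ENNReal.ofReal 2 by simp, ← ENNReal.ofReal_mul (by norm_num)]
    refine ENNReal.ofReal_le_ofReal ?_
    rw [← div_le_iff₀' (by norm_num)]
    refine Real.le_sqrt_of_sq_le ?_
    rcases le_total (1 / 2) |x i| with h | h
    · have : (1 / 2) ^ 2 ≤ x i ^ 2 := by rw [← sq_abs (x i)]; gcongr
      nlinarith [sq_nonneg (∑ k, x k ^ 2 - s ^ 2)]
    · have hi : x i ^ 2 ≤ s ^ 2 / 4 := by rw [← sq_abs (x i)]; nlinarith [abs_nonneg (x i)]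
      have hsum : ∑ k ∈ Finset.univ.erase i, x k ^ 2 ≤ n * (s / (2 * n)) ^ 2 := by
        calc _ ≤ ∑ k ∈ Finset.univ.erase i, (s / (2 * n)) ^ 2 := by
              refine Finset.sum_le_sum fun k hk => ?_
              rw [← sq_abs (x k)]
              gcongr
              rw [le_div_iff₀' (by positivity)]
              exact (hj k (Finset.ne_of_mem_erase hk)).le
          _ ≤ _ := by
              rw [Finset.sum_const, nsmul_eq_mul]
              gcongr
              simp
      have h4 : n * (s / (2 * n)) ^ 2 ≤ s ^ 2 / 4 := by
        rw [show (n : ℝ) * (s / (2 * n)) ^ 2 = s ^ 2 / 4 / n by field_simp; norm_num]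
        exact div_le_self (by positivity) hnR
      have h5 : ∑ k, x k ^ 2 ≤ s ^ 2 / 2 := by
        rw [← Finset.add_sum_erase _ _ (Finset.mem_univ i)]; linarith
      have h6 : (s ^ 2 / 2) ^ 2 ≤ (∑ k, x k ^ 2 - s ^ 2) ^ 2 := by
        nlinarith
      have h7 : (s / 2) ^ 2 ≤ (s ^ 2 / 2) ^ 2 := by
        gcongr
        nlinarith
      linarith [mul_nonneg (sq_nonneg s) (sq_nonneg (x i))]

theorem lintegral_prod_inv_one_add_sq {n : ℕ} (a : Fin n → ℝ) :
    ∫⁻ x : Fin n → ℝ, ∏ k, ENNReal.ofReal (1 + (x k - a k) ^ 2)⁻¹ =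
      (∫⁻ t : ℝ, ENNReal.ofReal (1 + t ^ 2)⁻¹) ^ n := by
  have hint : ∀ b : ℝ, Integrable fun t : ℝ => (1 + (t - b) ^ 2)⁻¹ :=
    fun b => integrable_inv_one_add_sq.comp_sub_right b
  have hI : Integrable fun x : Fin n → ℝ => ∏ k, (1 + (x k - a k) ^ 2)⁻¹ :=
    Integrable.fintype_prod (f := fun k (t : ℝ) => (1 + (t - a k) ^ 2)⁻¹) fun k => hint _
  have h0 : ∀ t : ℝ, 0 ≤ (1 + t ^ 2)⁻¹ := fun t => by positivity
  simp_rw [← ENNReal.ofReal_prod_of_nonneg fun k _ => h0 _]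
  rw [← ofReal_integral_eq_lintegral_ofReal hI
      (Filter.Eventually.of_forall fun x => Finset.prod_nonneg fun k _ => h0 _),
    integral_fintype_prod_volume_eq_prod (f := fun k (t : ℝ) => (1 + (t - a k) ^ 2)⁻¹),
    ← ofReal_integral_eq_lintegral_ofReal integrable_inv_one_add_sq (Filter.Eventually.of_forall h0),
    ← ENNReal.ofReal_pow (integral_nonneg h0)]
  congr 1
  rw [Finset.prod_congr rfl fun k _ => integral_sub_right_eq_self (fun t : ℝ => (1 + t ^ 2)⁻¹) (a k)]
  simp

/-- Integrating one coordinate against a factor whose weighted integrals in that coordinate are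
uniformly bounded. -/
theorem lintegral_prod_inv_one_add_sq_mul_le {n : ℕ} {C : ℝ≥0∞} (a : Fin n → ℝ) (j : Fin n)
    {q g : (Fin n → ℝ) → ℝ≥0∞} (hq : Measurable q) (hg : Measurable g)
    (hgj : ∀ x t, g (Function.update x j t) = g x)
    (h : ∀ x, ∫⁻ t : ℝ, ENNReal.ofReal (1 + (t - a j) ^ 2)⁻¹ * q (Function.update x j t) ≤
      C * ∫⁻ t : ℝ, ENNReal.ofReal (1 + t ^ 2)⁻¹) :
    ∫⁻ x : Fin n → ℝ, (∏ k, ENNReal.ofReal (1 + (x k - a k) ^ 2)⁻¹) * (g x * q x) ≤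
      C * ∫⁻ x : Fin n → ℝ, (∏ k, ENNReal.ofReal (1 + (x k - a k) ^ 2)⁻¹) * g x := by
  have hW : Measurable fun x : Fin n → ℝ => ∏ k, ENNReal.ofReal (1 + (x k - a k) ^ 2)⁻¹ := by
    fun_prop
  have hWg : Measurable fun x : Fin n → ℝ =>
      (∏ k, ENNReal.ofReal (1 + (x k - a k) ^ 2)⁻¹) * g x := hW.mul hg
  rw [← lintegral_const_mul _ hWg, volume_pi]
  refine lintegral_le_of_lmarginal_le {j} (hW.mul (hg.mul hq)) (hWg.const_mul C) ?_
  intro x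
  rw [lmarginal_singleton, lmarginal_singleton]
  have hprod : ∀ t : ℝ,
      ∏ k, ENNReal.ofReal (1 + (Function.update x j t k - a k) ^ 2)⁻¹ =
        ENNReal.ofReal (1 + (t - a j) ^ 2)⁻¹ *
          ∏ k ∈ Finset.univ.erase j, ENNReal.ofReal (1 + (x k - a k) ^ 2)⁻¹ := by
    intro t
    rw [← Finset.mul_prod_erase _ _ (Finset.mem_univ j), Function.update_self]
    congr 1
    refine Finset.prod_congr rfl fun k hk => ?_
    rw [Function.update_of_ne (Finset.ne_of_mem_erase hk)]
  simp only [hprod, hgj]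
  set R := ∏ k ∈ Finset.univ.erase j, ENNReal.ofReal (1 + (x k - a k) ^ 2)⁻¹
  have hqj : Measurable fun t => ENNReal.ofReal (1 + (t - a j) ^ 2)⁻¹ * q (Function.update x j t) :=
    Measurable.mul (by fun_prop) (hq.comp (measurable_update x))
  calc _ = ∫⁻ t : ℝ, R * g x *
        (ENNReal.ofReal (1 + (t - a j) ^ 2)⁻¹ * q (Function.update x j t)) := by
        refine lintegral_congr fun t => ?_
        ring
    _ ≤ R * g x * (C * ∫⁻ t : ℝ, ENNReal.ofReal (1 + t ^ 2)⁻¹) := by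
        rw [lintegral_const_mul _ hqj]
        gcongr
        exact h x
    _ = ∫⁻ t : ℝ, R * g x * C * ENNReal.ofReal (1 + (t - a j) ^ 2)⁻¹ := by
        rw [lintegral_const_mul _ (by fun_prop),
          lintegral_sub_right_eq_self (fun t : ℝ => ENNReal.ofReal (1 + t ^ 2)⁻¹) (a j)]
        ring
    _ = _ := by
        refine lintegral_congr fun t => ?_
        ring

theorem exists_lintegral_prod_mul_div_sqrt_le (n : ℕ) :
    ∃ C : ℝ≥0∞, C ≠ ∞ ∧ ∀ s : ℝ, 1 ≤ s → ∀ (i : Fin n) (a : Fin n → ℝ),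
      ∫⁻ x : Fin n → ℝ, (∏ k, ENNReal.ofReal (1 + (x k - a k) ^ 2)⁻¹) *
        (ENNReal.ofReal s / ENNReal.ofReal √((∑ k, x k ^ 2 - s ^ 2) ^ 2 + 4 * s ^ 2 * x i ^ 2)) ≤
      C := by
  obtain ⟨C₁, hC₁, h₁⟩ := exists_lintegral_inv_one_add_sq_mul_inv_sqrt_le
  set I := ∫⁻ t : ℝ, ENNReal.ofReal (1 + t ^ 2)⁻¹ with hI
  have hItop : I ≠ ∞ := lintegral_ofReal_inv_one_add_sq_ne_top
  have hI0 : I ≠ 0 := by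
    rw [hI, ← ofReal_integral_eq_lintegral_ofReal integrable_inv_one_add_sq
      (Filter.Eventually.of_forall fun t => by positivity), integral_univ_inv_one_add_sq]
    simp [Real.pi_pos]
  set D := C₁ / I
  have hD : D ≠ ∞ := ENNReal.div_ne_top hC₁ hI0
  have hDI : C₁ = D * I := (ENNReal.div_mul_cancel hI0 hItop).symm
  refine ⟨2 * I ^ n + n * (n * (D * (D * I ^ n) + D * (D * I ^ n))), by finiteness,
    fun s hs i a => ?_⟩
  set W : (Fin n → ℝ) → ℝ≥0∞ := fun x => ∏ k, ENNReal.ofReal (1 + (x k - a k) ^ 2)⁻¹ with hWdef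
  have hW : Measurable W := by fun_prop
  have hWI : ∫⁻ x, W x = I ^ n := lintegral_prod_inv_one_add_sq a
  have hsing : ∫⁻ x : Fin n → ℝ, W x * (ENNReal.ofReal √|x i|)⁻¹ ≤ D * I ^ n := by
    have := lintegral_prod_inv_one_add_sq_mul_le (C := D) a i
      (q := fun x => (ENNReal.ofReal √|x i|)⁻¹) (g := fun _ => 1) (by fun_prop) (by fun_prop)
      (fun _ _ => rfl) (fun x => by
        simp only [Function.update_self]
        rw [← hI, ← hDI]
        simpa using h₁ (a i) 0)
    simpa [← hWI, hWdef] using this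
  have hdouble : ∀ j ≠ i, ∀ ρ : (Fin n → ℝ) → ℝ, Measurable ρ →
      (∀ x t, ρ (Function.update x j t) = ρ x) →
      ∫⁻ x : Fin n → ℝ, W x *
        ((ENNReal.ofReal √|x i|)⁻¹ * (ENNReal.ofReal √|x j - ρ x|)⁻¹) ≤ D * (D * I ^ n) := by
    intro j hj ρ hρ hρj
    refine (lintegral_prod_inv_one_add_sq_mul_le (C := D) a j
      (q := fun x => (ENNReal.ofReal √|x j - ρ x|)⁻¹)
      (g := fun x => (ENNReal.ofReal √|x i|)⁻¹) (by fun_prop) (by fun_prop)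
      (fun x t => by rw [Function.update_of_ne hj.symm]) (fun x => ?_)).trans
      (mul_le_mul_right hsing D)
    simp only [Function.update_self, hρj]
    rw [← hI, ← hDI]
    exact h₁ _ _
  have hρ : ∀ j : Fin n, Measurable fun x : Fin n → ℝ =>
      √(s ^ 2 - ∑ k ∈ Finset.univ.erase j, x k ^ 2) := fun j => by fun_prop
  have hρj : ∀ (j : Fin n) (x : Fin n → ℝ) (t : ℝ),
      √(s ^ 2 - ∑ k ∈ Finset.univ.erase j, Function.update x j t k ^ 2) =
        √(s ^ 2 - ∑ k ∈ Finset.univ.erase j, x k ^ 2) := by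
    intro j x t
    congr 2
    refine Finset.sum_congr rfl fun k hk => ?_
    rw [Function.update_of_ne (Finset.ne_of_mem_erase hk)]
  calc _ ≤ ∫⁻ x, W x * (2 + ∑ j ∈ Finset.univ.erase i, n * ((ENNReal.ofReal √|x i|)⁻¹ *
        (ENNReal.ofReal √|x j - √(s ^ 2 - ∑ k ∈ Finset.univ.erase j, x k ^ 2)|)⁻¹ +
        (ENNReal.ofReal √|x i|)⁻¹ *
        (ENNReal.ofReal √|x j - -√(s ^ 2 - ∑ k ∈ Finset.univ.erase j, x k ^ 2)|)⁻¹)) := by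
        gcongr with x
        exact ofReal_div_ofReal_sqrt_le hs i x
    _ = 2 * (∫⁻ x, W x) + ∑ j ∈ Finset.univ.erase i, n *
        ((∫⁻ x, W x * ((ENNReal.ofReal √|x i|)⁻¹ *
          (ENNReal.ofReal √|x j - √(s ^ 2 - ∑ k ∈ Finset.univ.erase j, x k ^ 2)|)⁻¹)) +
        ∫⁻ x, W x * ((ENNReal.ofReal √|x i|)⁻¹ *
          (ENNReal.ofReal √|x j - -√(s ^ 2 - ∑ k ∈ Finset.univ.erase j, x k ^ 2)|)⁻¹)) := by
        simp only [mul_add, Finset.mul_sum]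
        rw [lintegral_add_left (by fun_prop), lintegral_finsetSum _ (fun j _ => by fun_prop),
          lintegral_mul_const _ hW, mul_comm 2]
        congr 1
        refine Finset.sum_congr rfl fun j _ => ?_
        simp only [mul_left_comm (W _) (n : ℝ≥0∞)]
        rw [lintegral_add_left (by fun_prop), lintegral_const_mul _ (by fun_prop),
          lintegral_const_mul _ (by fun_prop)]
    _ ≤ 2 * I ^ n + ∑ j ∈ Finset.univ.erase i, n * (D * (D * I ^ n) + D * (D * I ^ n)) := by
        rw [hWI]
        gcongr with j hj
        · exact hdouble j (Finset.ne_of_mem_erase hj) _ (hρ j) (hρj j)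
        · exact hdouble j (Finset.ne_of_mem_erase hj) _ (hρ j).neg fun x t => by rw [hρj j x t]
    _ ≤ _ := by
        rw [Finset.sum_const, nsmul_eq_mul]
        gcongr
        simp

section pAbs

variable {n : ℕ} {s : ℝ} {e₁ e₂ : EuclideanSpace ℝ (Fin n)}

theorem pAbs_nonneg (ξ : EuclideanSpace ℝ (Fin n)) : 0 ≤ pAbs s e₁ e₂ ξ := Real.sqrt_nonneg _

theorem continuous_pAbs : Continuous (pAbs s e₁ e₂) := by
  unfold pAbs
  fun_prop

theorem abs_re_le_pAbs (ξ : EuclideanSpace ℝ (Fin n)) :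
    |‖ξ‖ ^ 2 - 2 * s * ⟪e₂, ξ⟫| ≤ pAbs s e₁ e₂ ξ :=
  Real.abs_le_sqrt (by nlinarith [sq_nonneg (s * ⟪e₁, ξ⟫)])

theorem abs_im_le_pAbs (ξ : EuclideanSpace ℝ (Fin n)) :
    |2 * s * ⟪e₁, ξ⟫| ≤ pAbs s e₁ e₂ ξ :=
  Real.abs_le_sqrt (by nlinarith [sq_nonneg (‖ξ‖ ^ 2 - 2 * s * ⟪e₂, ξ⟫)])

theorem pAbs_le (ξ : EuclideanSpace ℝ (Fin n)) :
    pAbs s e₁ e₂ ξ ≤ |‖ξ‖ ^ 2 - 2 * s * ⟪e₂, ξ⟫| + |2 * s * ⟪e₁, ξ⟫| := by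
  refine Real.sqrt_le_iff.2 ⟨by positivity, ?_⟩
  rw [add_sq, sq_abs, sq_abs]
  have : 0 ≤ |‖ξ‖ ^ 2 - 2 * s * ⟪e₂, ξ⟫| * |2 * s * ⟪e₁, ξ⟫| := by positivity
  nlinarith

/-- The weight `s + |p_ζ|` varies slowly. -/
theorem add_pAbs_le (hs : 1 ≤ s) (h₁ : ‖e₁‖ = 1) (h₂ : ‖e₂‖ = 1)
    (ξ η : EuclideanSpace ℝ (Fin n)) :
    s + pAbs s e₁ e₂ ξ ≤ 3 * (1 + ‖ξ - η‖ ^ 2) * (s + pAbs s e₁ e₂ η) := by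
  obtain ⟨d, rfl⟩ : ∃ d, ξ = η + d := ⟨ξ - η, by abel⟩
  rw [add_sub_cancel_left]
  set ω := η - s • e₂ with hω
  have hnorm : ‖ω‖ ^ 2 = ‖η‖ ^ 2 - 2 * s * ⟪e₂, η⟫ + s ^ 2 := by
    rw [hω, norm_sub_sq_real, inner_smul_right, norm_smul, h₂, real_inner_comm, mul_one,
      Real.norm_eq_abs, sq_abs]
    ring
  have hre : ‖η + d‖ ^ 2 - 2 * s * ⟪e₂, η + d⟫ =
      (‖η‖ ^ 2 - 2 * s * ⟪e₂, η⟫) + (2 * ⟪ω, d⟫ + ‖d‖ ^ 2) := by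
    rw [hω, norm_add_sq_real, inner_add_right, inner_sub_left, real_inner_smul_left]
    ring
  have him : 2 * s * ⟪e₁, η + d⟫ = 2 * s * ⟪e₁, η⟫ + 2 * s * ⟪e₁, d⟫ := by
    rw [inner_add_right]; ring
  have hinner₁ : |⟪e₁, d⟫| ≤ ‖d‖ := by simpa [h₁] using abs_real_inner_le_norm e₁ d
  have hinner : |⟪ω, d⟫| ≤ ‖ω‖ * ‖d‖ := abs_real_inner_le_norm ω d
  have hA := abs_re_le_pAbs (s := s) (e₁ := e₁) (e₂ := e₂) η
  have hB := abs_im_le_pAbs (s := s) (e₁ := e₁) (e₂ := e₂) η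
  have hξ := pAbs_le (s := s) (e₁ := e₁) (e₂ := e₂) (η + d)
  have hP := pAbs_nonneg (s := s) (e₁ := e₁) (e₂ := e₂) η
  rw [hre, him] at hξ
  set P := pAbs s e₁ e₂ η
  have hωP : ‖ω‖ ^ 2 ≤ s ^ 2 + P := by
    have := (le_abs_self _).trans hA
    linarith
  have hωd : 2 * (‖ω‖ * ‖d‖) ≤ s + P + s * ‖d‖ ^ 2 := by
    have h1 : 0 ≤ (‖ω‖ - s * ‖d‖) ^ 2 := sq_nonneg _
    have h2 : s * (2 * (‖ω‖ * ‖d‖)) ≤ s * (s + P + s * ‖d‖ ^ 2) := by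
      nlinarith [mul_nonneg (sub_nonneg.2 hs) hP]
    exact le_of_mul_le_mul_left h2 (by linarith)
  have hre' := abs_add_le (‖η‖ ^ 2 - 2 * s * ⟪e₂, η⟫) (2 * ⟪ω, d⟫ + ‖d‖ ^ 2)
  have hre'' := abs_add_le (2 * ⟪ω, d⟫) (‖d‖ ^ 2)
  have him' := abs_add_le (2 * s * ⟪e₁, η⟫) (2 * s * ⟪e₁, d⟫)
  rw [abs_mul 2, abs_two, abs_of_nonneg (sq_nonneg ‖d‖)] at hre''
  rw [abs_mul (2 * s) ⟪e₁, d⟫, abs_of_nonneg (by linarith : 0 ≤ 2 * s)] at him'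
  have hd : 2 * s * |⟪e₁, d⟫| ≤ s + s * ‖d‖ ^ 2 := by
    calc _ ≤ 2 * s * ‖d‖ := by gcongr
      _ ≤ _ := by nlinarith [mul_nonneg (by linarith : 0 ≤ s) (sq_nonneg (‖d‖ - 1))]
  have hds : ‖d‖ ^ 2 ≤ s * ‖d‖ ^ 2 := le_mul_of_one_le_left (sq_nonneg _) hs
  have hdP : 0 ≤ ‖d‖ ^ 2 * P := by positivity
  nlinarith

theorem exists_lintegral_inv_pow_mul_div_pAbs_le (n : ℕ) :
    ∃ C : ℝ≥0∞, C ≠ ∞ ∧ ∀ s : ℝ, 1 ≤ s → ∀ e₁ e₂ : EuclideanSpace ℝ (Fin n),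
      ‖e₁‖ = 1 → ‖e₂‖ = 1 → ⟪e₁, e₂⟫ = 0 → ∀ ξ : EuclideanSpace ℝ (Fin n),
      ∫⁻ η, ENNReal.ofReal ((1 + ‖ξ - η‖ ^ 2) ^ n)⁻¹ *
        (ENNReal.ofReal s / ENNReal.ofReal (pAbs s e₁ e₂ η)) ≤ C := by
  obtain ⟨C, hC, h⟩ := exists_lintegral_prod_mul_div_sqrt_le n
  refine ⟨C, hC, fun s hs e₁ e₂ h₁ h₂ h₁₂ ξ => ?_⟩
  have hn : 0 < n := by
    rcases Nat.eq_zero_or_pos n with rfl | hn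
    · rw [Subsingleton.elim e₁ 0] at h₁
      simp at h₁
    · exact hn
  let i : Fin n := ⟨0, hn⟩
  obtain ⟨b, hb⟩ := Orthonormal.exists_orthonormalBasis_extension_of_card_eq (𝕜 := ℝ)
    (E := EuclideanSpace ℝ (Fin n)) (ι := Fin n) (by simp) (v := fun _ => e₁) (s := {i})
    (by
      refine ⟨fun _ => h₁, fun j k hjk => ?_⟩
      exact absurd (Subsingleton.elim j k) hjk)
  have hbi : b i = e₁ := hb i rfl
  let T : (Fin n → ℝ) → EuclideanSpace ℝ (Fin n) := fun x => s • e₂ + b.repr.symm (WithLp.toLp 2 x)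
  have hT : MeasurePreserving T :=
    ((measurePreserving_add_left volume (s • e₂)).comp b.measurePreserving_repr_symm).comp
      (PiLp.volume_preserving_toLp (Fin n))
  have hmeas : Measurable fun η : EuclideanSpace ℝ (Fin n) =>
      ENNReal.ofReal ((1 + ‖ξ - η‖ ^ 2) ^ n)⁻¹ *
        (ENNReal.ofReal s / ENNReal.ofReal (pAbs s e₁ e₂ η)) := by
    have := (continuous_pAbs (s := s) (e₁ := e₁) (e₂ := e₂)).measurable
    fun_prop
  rw [← hT.lintegral_comp hmeas]
  set a : Fin n → ℝ := WithLp.ofLp (b.repr (ξ - s • e₂)) with ha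
  refine le_trans (lintegral_mono fun x => ?_) (h s hs i a)
  have hsq : ∀ y : Fin n → ℝ, ‖b.repr.symm (WithLp.toLp 2 y)‖ ^ 2 = ∑ k, y k ^ 2 := by
    intro y
    rw [LinearIsometryEquiv.norm_map, EuclideanSpace.norm_sq_eq]
    simp
  have hdist : ‖ξ - T x‖ ^ 2 = ∑ k, (x k - a k) ^ 2 := by
    have : ξ - T x = b.repr.symm (WithLp.toLp 2 (a - x)) := by
      rw [WithLp.toLp_sub, map_sub, ha, WithLp.toLp_ofLp, LinearIsometryEquiv.symm_apply_apply]
      simp only [T]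
      abel
    rw [this, hsq]
    exact Finset.sum_congr rfl fun k _ => by simp only [Pi.sub_apply]; ring
  have hinner : ⟪e₁, b.repr.symm (WithLp.toLp 2 x)⟫ = x i := by
    rw [← hbi, ← b.repr_apply_apply, LinearIsometryEquiv.apply_symm_apply]
  have hp : pAbs s e₁ e₂ (T x) = √((∑ k, x k ^ 2 - s ^ 2) ^ 2 + 4 * s ^ 2 * x i ^ 2) := by
    unfold pAbs
    have h3 : ‖T x‖ ^ 2 - 2 * s * ⟪e₂, T x⟫ = ∑ k, x k ^ 2 - s ^ 2 := by
      simp only [T]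
      rw [norm_add_sq_real, hsq, inner_add_right, real_inner_smul_left, real_inner_smul_right,
        real_inner_self_eq_norm_sq, norm_smul, h₂, Real.norm_eq_abs, mul_one, sq_abs]
      ring
    have h4 : ⟪e₁, T x⟫ = x i := by
      simp only [T]
      rw [inner_add_right, real_inner_smul_right, h₁₂, hinner, mul_zero, zero_add]
    rw [h3, h4]
  rw [hp, ← ENNReal.ofReal_prod_of_nonneg fun k _ => by positivity]
  gcongr
  rw [hdist, Finset.prod_inv_distrib]
  gcongr
  calc ∏ k, (1 + (x k - a k) ^ 2) ≤ ∏ _k : Fin n, (1 + ∑ k, (x k - a k) ^ 2) := by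
        refine Finset.prod_le_prod (fun k _ => by positivity) fun k _ => ?_
        gcongr
        exact Finset.single_le_sum (f := fun k => (x k - a k) ^ 2) (fun k _ => sq_nonneg _)
          (Finset.mem_univ k)
    _ = _ := by simp

end pAbs

theorem SchwartzMap.exists_norm_le_inv_one_add_norm_sq_pow {E F : Type*} [NormedAddCommGroup E]
    [NormedSpace ℝ E] [NormedAddCommGroup F] [NormedSpace ℝ F] (f : SchwartzMap E F) (k : ℕ) :
    ∃ C : ℝ, 0 ≤ C ∧ ∀ x, ‖f x‖ ≤ C * ((1 + ‖x‖ ^ 2) ^ k)⁻¹ := by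
  refine ⟨2 ^ (2 * k) * (Finset.Iic (2 * k, 0)).sup
    (fun m => SchwartzMap.seminorm ℝ m.1 m.2) f, by positivity, fun x => ?_⟩
  have h := SchwartzMap.one_add_le_sup_seminorm_apply (𝕜 := ℝ) (m := (2 * k, 0)) le_rfl le_rfl f x
  rw [norm_iteratedFDeriv_zero] at h
  rw [← div_eq_mul_inv, le_div_iff₀' (by positivity)]
  refine le_trans ?_ h
  dsimp only
  rw [pow_mul]
  gcongr
  nlinarith [norm_nonneg x]

theorem exists_mul_lintegral_div_pAbs_le {n : ℕ} (hn : 0 < n)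
    (f : SchwartzMap (EuclideanSpace ℝ (Fin n)) ℂ) :
    ∃ C : ℝ≥0∞, C ≠ ∞ ∧ ∀ s : ℝ, 1 ≤ s → ∀ e₁ e₂ : EuclideanSpace ℝ (Fin n),
      ‖e₁‖ = 1 → ‖e₂‖ = 1 → ⟪e₁, e₂⟫ = 0 → ∀ ξ : EuclideanSpace ℝ (Fin n),
      ENNReal.ofReal (s + pAbs s e₁ e₂ ξ) *
        ∫⁻ η, ‖f (ξ - η)‖ₑ / ENNReal.ofReal (pAbs s e₁ e₂ η) ≤ C := by
  obtain ⟨C₀, hC₀, hf⟩ := f.exists_norm_le_inv_one_add_norm_sq_pow (n + 1)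
  obtain ⟨C₁, hC₁, h₁⟩ := exists_lintegral_inv_pow_mul_div_pAbs_le n
  set w : EuclideanSpace ℝ (Fin n) → ℝ≥0∞ := fun y => ENNReal.ofReal ((1 + ‖y‖ ^ 2) ^ n)⁻¹
  have hw : Measurable w := by fun_prop
  have hwtop : ∫⁻ y, w y ≠ ∞ := by
    have hint : Integrable fun y : EuclideanSpace ℝ (Fin n) => ((1 + ‖y‖ ^ 2) ^ n)⁻¹ := by
      refine (integrable_rpow_neg_one_add_norm_sq (E := EuclideanSpace ℝ (Fin n)) (μ := volume)
        (r := 2 * n) ?_).congr (Filter.Eventually.of_forall fun y => ?_)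
      · have : (0 : ℝ) < n := by exact_mod_cast hn
        simp only [finrank_euclideanSpace, Fintype.card_fin]
        linarith
      · simp only
        rw [show -(2 * (n : ℝ)) / 2 = -n by ring, Real.rpow_neg (by positivity), Real.rpow_natCast]
    exact hint.lintegral_lt_top.ne
  refine ⟨ENNReal.ofReal (3 * C₀) * (C₁ + ∫⁻ y, w y), by finiteness,
    fun s hs e₁ e₂ he₁ he₂ he ξ => ?_⟩
  set P : EuclideanSpace ℝ (Fin n) → ℝ := pAbs s e₁ e₂
  have hP : Measurable P := continuous_pAbs.measurable
  have hwξ : Measurable fun η => w (ξ - η) := by fun_prop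
  have hpoint : ∀ η, ENNReal.ofReal (s + P ξ) * (‖f (ξ - η)‖ₑ / ENNReal.ofReal (P η)) ≤
      ENNReal.ofReal (3 * C₀) *
        (w (ξ - η) * (ENNReal.ofReal s / ENNReal.ofReal (P η)) + w (ξ - η)) := by
    intro η
    have hPη : 0 ≤ P η := pAbs_nonneg η
    have hreal : (s + P ξ) * ‖f (ξ - η)‖ ≤ 3 * C₀ * ((1 + ‖ξ - η‖ ^ 2) ^ n)⁻¹ * (s + P η) := by
      calc _ ≤ (3 * (1 + ‖ξ - η‖ ^ 2) * (s + P η)) *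
            (C₀ * ((1 + ‖ξ - η‖ ^ 2) ^ (n + 1))⁻¹) := by
            gcongr
            · exact add_pAbs_le hs he₁ he₂ ξ η
            · exact hf _
        _ = _ := by
            have : (1 + ‖ξ - η‖ ^ 2) ≠ 0 := by positivity
            field_simp
            ring
    calc _ = ENNReal.ofReal ((s + P ξ) * ‖f (ξ - η)‖) / ENNReal.ofReal (P η) := by
          rw [ENNReal.ofReal_mul' (norm_nonneg _), ofReal_norm, mul_div_assoc]
      _ ≤ ENNReal.ofReal (3 * C₀ * ((1 + ‖ξ - η‖ ^ 2) ^ n)⁻¹ * (s + P η)) /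
            ENNReal.ofReal (P η) := by gcongr
      _ = ENNReal.ofReal (3 * C₀) * (w (ξ - η) * (ENNReal.ofReal s / ENNReal.ofReal (P η)) +
            w (ξ - η) * (ENNReal.ofReal (P η) / ENNReal.ofReal (P η))) := by
          rw [ENNReal.ofReal_mul (by positivity), ENNReal.ofReal_mul (by positivity),
            ENNReal.ofReal_add (by linarith) hPη, ← mul_add, ← ENNReal.add_div, mul_assoc,
            mul_div_assoc, mul_div_assoc]
      _ ≤ _ := by
          gcongr
          exact mul_le_of_le_one_right zero_le ENNReal.div_self_le_one
  calc _ = ∫⁻ η, ENNReal.ofReal (s + P ξ) * (‖f (ξ - η)‖ₑ / ENNReal.ofReal (P η)) := by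
        have hfξ : Measurable fun η => ‖f (ξ - η)‖ₑ :=
          (f.continuous.comp (continuous_const.sub continuous_id)).enorm.measurable
        have hfP : Measurable fun η => ‖f (ξ - η)‖ₑ / ENNReal.ofReal (P η) :=
          hfξ.div hP.ennreal_ofReal
        rw [lintegral_const_mul _ hfP]
    _ ≤ ∫⁻ η, ENNReal.ofReal (3 * C₀) *
        (w (ξ - η) * (ENNReal.ofReal s / ENNReal.ofReal (P η)) + w (ξ - η)) :=
        lintegral_mono hpoint
    _ = ENNReal.ofReal (3 * C₀) *
        ((∫⁻ η, w (ξ - η) * (ENNReal.ofReal s / ENNReal.ofReal (P η))) + ∫⁻ y, w y) := by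
        rw [lintegral_const_mul _ (by fun_prop), lintegral_add_right _ hwξ,
          lintegral_sub_left_eq_self w ξ]
    _ ≤ _ := by
        gcongr
        exact h₁ s hs e₁ e₂ he₁ he₂ he ξ

theorem integrable_pAbs_mul_norm_sq {n : ℕ} {s : ℝ} {e₁ e₂ : EuclideanSpace ℝ (Fin n)} (hs : 1 ≤ s)
    (h₁ : ‖e₁‖ = 1) (h₂ : ‖e₂‖ = 1) (g : SchwartzMap (EuclideanSpace ℝ (Fin n)) ℂ) :
    Integrable fun ξ => pAbs s e₁ e₂ ξ * ‖g ξ‖ ^ 2 := by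
  obtain ⟨M, hM, hg⟩ := g.exists_norm_le_inv_one_add_norm_sq_pow 0
  simp only [pow_zero, inv_one, mul_one] at hg
  have hcont : Continuous fun ξ => pAbs s e₁ e₂ ξ * ‖g ξ‖ ^ 2 :=
    continuous_pAbs.mul (g.continuous.norm.pow 2)
  refine Integrable.mono' (((g.integrable.norm).add (g.integrable_pow_mul volume 2)).const_mul
    (3 * (s + pAbs s e₁ e₂ 0) * M)) hcont.aestronglyMeasurable
    (Filter.Eventually.of_forall fun ξ => ?_)
  have h0 := pAbs_nonneg (s := s) (e₁ := e₁) (e₂ := e₂) 0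
  have hξ := pAbs_nonneg (s := s) (e₁ := e₁) (e₂ := e₂) ξ
  have h := add_pAbs_le hs h₁ h₂ ξ 0
  rw [sub_zero] at h
  rw [Real.norm_of_nonneg (by positivity), Pi.add_apply]
  calc pAbs s e₁ e₂ ξ * ‖g ξ‖ ^ 2 = pAbs s e₁ e₂ ξ * (‖g ξ‖ * ‖g ξ‖) := by ring
    _ ≤ 3 * (1 + ‖ξ‖ ^ 2) * (s + pAbs s e₁ e₂ 0) * (M * ‖g ξ‖) := by
        gcongr
        · linarith
        · exact hg ξ
    _ = _ := by ring

/-- `‖Φu‖_{X^{1/2}_ζ} ≲ ‖u‖_{Ẋ^{1/2}_ζ}` uniformly over `s ≥ 1` and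
orthonormal `e₁, e₂`, for a fixed Schwartz cutoff `Φ`. -/
theorem stmt_13 (n : ℕ) (hn : 2 ≤ n)
    (Φ : SchwartzMap (EuclideanSpace ℝ (Fin n)) ℂ) :
    ∃ C > 0, ∀ s ≥ (1 : ℝ), ∀ e₁ e₂ : EuclideanSpace ℝ (Fin n),
      ‖e₁‖ = 1 → ‖e₂‖ = 1 → ⟪e₁, e₂⟫ = 0 →
      ∀ u : SchwartzMap (EuclideanSpace ℝ (Fin n)) ℂ,
        ∫ ξ, (s + pAbs s e₁ e₂ ξ) * ‖𝓕 (fun x => Φ x * u x) ξ‖ ^ 2 ≤ C * ∫ ξ, pAbs s e₁ e₂ ξ * ‖𝓕 (⇑u) ξ‖ ^ 2 := by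
  obtain ⟨C, hC, h⟩ := exists_mul_lintegral_div_pAbs_le (by omega) (𝓕 Φ)
  set D := C * ∫⁻ ξ, ‖𝓕 Φ ξ‖ₑ
  have hD : D ≠ ∞ := ENNReal.mul_ne_top hC (𝓕 Φ).integrable.hasFiniteIntegral.ne
  refine ⟨D.toReal + 1, by positivity, fun s hs e₁ e₂ h₁ h₂ h₁₂ u => ?_⟩
  have hint := integrable_pAbs_mul_norm_sq hs h₁ h₂ (𝓕 u)
  rw [SchwartzMap.fourier_coe] at hint
  have hnn : ∀ ξ, 0 ≤ pAbs s e₁ e₂ ξ * ‖𝓕 (⇑u) ξ‖ ^ 2 :=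
    fun ξ => mul_nonneg (pAbs_nonneg ξ) (sq_nonneg _)
  have hI : 0 ≤ ∫ ξ, pAbs s e₁ e₂ ξ * ‖𝓕 (⇑u) ξ‖ ^ 2 := integral_nonneg hnn
  have hcontΦ : Continuous (𝓕 (⇑Φ)) := (𝓕 Φ).continuous
  have hcontu : Continuous (𝓕 (⇑u)) := (𝓕 u).continuous
  have schur := lintegral_mul_convolution_sq_le (μ := volume) (C := C)
    (F := fun y => ‖𝓕 (⇑Φ) y‖ₑ) (U := fun y => ‖𝓕 (⇑u) y‖ₑ)
    (P := fun y => ENNReal.ofReal (pAbs s e₁ e₂ y))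
    (Q := fun y => ENNReal.ofReal (s + pAbs s e₁ e₂ y))
    hcontΦ.enorm.measurable hcontu.enorm.measurable continuous_pAbs.measurable.ennreal_ofReal
    (fun _ => ENNReal.ofReal_ne_top)
    (fun ξ => (ENNReal.ofReal_pos.2 (by linarith [pAbs_nonneg (s := s) (e₁ := e₁) (e₂ := e₂) ξ])).ne')
    hC (h s hs e₁ e₂ h₁ h₂ h₁₂)
  rw [← ENNReal.ofReal_le_ofReal_iff (by positivity)]
  calc _ ≤ ‖∫ ξ, (s + pAbs s e₁ e₂ ξ) * ‖𝓕 (fun x => Φ x * u x) ξ‖ ^ 2‖ₑ :=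
        Real.ofReal_le_enorm _
    _ ≤ ∫⁻ ξ, ‖(s + pAbs s e₁ e₂ ξ) * ‖𝓕 (fun x => Φ x * u x) ξ‖ ^ 2‖ₑ :=
        enorm_integral_le_lintegral_enorm _
    _ ≤ ∫⁻ ξ, ENNReal.ofReal (s + pAbs s e₁ e₂ ξ) *
        (∫⁻ η, ‖𝓕 (⇑Φ) (ξ - η)‖ₑ * ‖𝓕 (⇑u) η‖ₑ) ^ 2 := by
        refine lintegral_mono fun ξ => ?_
        have hξ := pAbs_nonneg (s := s) (e₁ := e₁) (e₂ := e₂) ξ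
        rw [enorm_mul, enorm_pow, enorm_norm, Real.enorm_of_nonneg (by linarith)]
        gcongr
        exact Φ.enorm_fourier_mul_le u ξ
    _ ≤ D * ∫⁻ η, ENNReal.ofReal (pAbs s e₁ e₂ η) * ‖𝓕 (⇑u) η‖ₑ ^ 2 := schur
    _ = ENNReal.ofReal D.toReal * ENNReal.ofReal (∫ ξ, pAbs s e₁ e₂ ξ * ‖𝓕 (⇑u) ξ‖ ^ 2) := by
        rw [ENNReal.ofReal_toReal hD,
          ofReal_integral_eq_lintegral_ofReal hint (Filter.Eventually.of_forall hnn)]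
        congr 1
        refine lintegral_congr fun ξ => ?_
        rw [ENNReal.ofReal_mul (pAbs_nonneg ξ), ENNReal.ofReal_pow (norm_nonneg _),
          ofReal_norm]
    _ ≤ _ := by
        rw [← ENNReal.ofReal_mul ENNReal.toReal_nonneg]
        gcongr
        linarith
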